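/- Fix an integer n ≥ 2. There is a constant C = C(n) > 0 and, for each N, a set E_N ⊆ 𝒫⁰_{n,N} with |E_N| = o(Nⁿ) as N → ∞, such that for every f ∈ 𝒫⁰_{n,N} \ E_N the number of primes ramified in ℚ_f/ℚ is at most C·log log N. -/

import Mathlib

/-!
Arithmetic statistics of families of integer `S_n`-polynomials (I. Viglino).

`𝒫_{n,N}` is the family of monic integer polynomials
`f(X) = X^n + a_{n-1}X^{n-1} + ⋯ + a_0` with `|a_i| ≤ N`, identified with their
coefficient vectors `a : Fin n → ℤ`, and `𝒫⁰_{n,N} ⊆ 𝒫_{n,N}` is the subfamily of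
`f` whose splitting field over `ℚ` has Galois group isomorphic to `S_n`.
-/

open Polynomial Finset Filter

attribute [local instance] Classical.propDecidable

noncomputable section

/-- The monic integer polynomial `X^n + a_{n-1}X^{n-1} + ⋯ + a_0`. -/
def intPoly (n : ℕ) (a : Fin n → ℤ) : Polynomial ℤ :=
  Polynomial.X ^ n + ∑ i : Fin n, Polynomial.C (a i) * Polynomial.X ^ (i : ℕ)

/-- The same polynomial viewed over `ℚ`. -/
def ratPoly (n : ℕ) (a : Fin n → ℤ) : Polynomial ℚ :=
  (intPoly n a).map (Int.castRingHom ℚ)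

/-- Coefficient vectors with entries in `{-N, …, N}`: the family `𝒫_{n,N}`. -/
def coeffBox (n N : ℕ) : Finset (Fin n → ℤ) :=
  Fintype.piFinset fun _ => Finset.Icc (-(N : ℤ)) (N : ℤ)

/-- `f` is an `S_n`-polynomial: the Galois group of its splitting field `K_f` over `ℚ`
is isomorphic to the symmetric group on `n` letters. -/
def IsSnPoly (n : ℕ) (a : Fin n → ℤ) : Prop :=
  Nonempty ((ratPoly n a).Gal ≃* Equiv.Perm (Fin n))

/-- The family `𝒫⁰_{n,N}` of `S_n`-polynomials, as a finset of coefficient vectors. -/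
def P0 (n N : ℕ) : Finset (Fin n → ℤ) :=
  (coeffBox n N).filter fun a => IsSnPoly n a

/-- `ℙ_N`, the uniform probability of an event in `𝒫⁰_{n,N}`. -/
def probN (n N : ℕ) (E : (Fin n → ℤ) → Prop) : ℝ :=
  (((P0 n N).filter E).card : ℝ) / ((P0 n N).card : ℝ)

/-- `𝔼_N`, the expectation of a real random variable on `𝒫⁰_{n,N}`. -/
def expN (n N : ℕ) (F : (Fin n → ℤ) → ℝ) : ℝ :=
  (∑ a ∈ P0 n N, F a) / ((P0 n N).card : ℝ)

/-- `π(x)`, the number of rational primes `≤ x`. -/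
def primePi (x : ℝ) : ℕ :=
  ((Finset.range (⌊x⌋₊ + 1)).filter Nat.Prime).card

/-- `g ∈ 𝔽_p[X]` has splitting type `r = (r_1, …, r_n)` — encoded by `r : Fin n → ℕ` where
`r i` is `r_{i+1}`, the number of factors of degree `i+1` —, i.e. `g` is a product of
distinct monic irreducible polynomials with exactly `r i` monic irreducible factors of
degree `i+1` for each `i`. -/
def SplitTypeOf {p : ℕ} (g : Polynomial (ZMod p)) {n : ℕ} (r : Fin n → ℕ) : Prop :=
  Squarefree g ∧ ∀ i : Fin n,
    Nat.card {h : Polynomial (ZMod p) // h.Monic ∧ Irreducible h ∧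
      h.natDegree = (i : ℕ) + 1 ∧ h ∣ g} = r i

/-- `f` has splitting type `r` modulo `p`. -/
def HasSplitType (n : ℕ) (r : Fin n → ℕ) (a : Fin n → ℤ) (p : ℕ) : Prop :=
  SplitTypeOf ((intPoly n a).map (Int.castRingHom (ZMod p))) r

/-- `π_{f,r}(x)`: the number of primes `p ≤ x` such that `f` has splitting type `r` mod `p`. -/
def countSplit (n : ℕ) (r : Fin n → ℕ) (a : Fin n → ℤ) (x : ℝ) : ℕ :=
  ((Finset.range (⌊x⌋₊ + 1)).filter fun p => p.Prime ∧ HasSplitType n r a p).card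

/-- `δ(r) = ∏_{i=1}^n 1/(i^{r_i}·r_i!)`. -/
def splitDelta (n : ℕ) (r : Fin n → ℕ) : ℝ :=
  ∏ i : Fin n, (1 : ℝ) / ((((i : ℕ) + 1) ^ (r i) * Nat.factorial (r i) : ℕ) : ℝ)

/-- `r_i` as a function of the index `i ≥ 1` (so `rget n r 1 = r_1`, etc.). -/
def rget (n : ℕ) (r : Fin n → ℕ) (i : ℕ) : ℕ :=
  if h : i - 1 < n then r ⟨i - 1, h⟩ else 0

/-- `C_r = δ(r)·r_2(r_2−1)(r_1+1)(r_1+2)/(2^{r_2+1}·r_1!·r_2!)`. -/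
def splitCr (n : ℕ) (r : Fin n → ℕ) : ℝ :=
  splitDelta n r *
    ((rget n r 2 : ℝ) * ((rget n r 2 : ℝ) - 1) *
      ((rget n r 1 : ℝ) + 1) * ((rget n r 1 : ℝ) + 2)) /
    ((2 : ℝ) ^ (rget n r 2 + 1) * (Nat.factorial (rget n r 1) : ℝ) *
      (Nat.factorial (rget n r 2) : ℝ))

/-- The discriminant `D'_{ℚ_f}` of the number field `ℚ_f = ℚ(α) ≃ ℚ[X]/(f)` generated by a
root `α` of `f` (with its sign; `D_{ℚ_f}` is its absolute value), or `0` if `f` is not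
irreducible over `ℚ`. -/
def fieldDisc (n : ℕ) (a : Fin n → ℤ) : ℤ :=
  if h : Irreducible (ratPoly n a) then
    haveI : Fact (Irreducible (ratPoly n a)) := ⟨h⟩
    haveI : CharZero (AdjoinRoot (ratPoly n a)) :=
      charZero_of_injective_algebraMap (algebraMap ℚ (AdjoinRoot (ratPoly n a))).injective
    haveI : FiniteDimensional ℚ (AdjoinRoot (ratPoly n a)) :=
      PowerBasis.finite (AdjoinRoot.powerBasis h.ne_zero)
    NumberField.discr (AdjoinRoot (ratPoly n a))
  else 0

lemma factorial_mul_sum_powersetCard_prod_le {ι : Type*} (x : ι → ℝ) (hx : ∀ p, 0 ≤ x p)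
    (s : Finset ι) (k : ℕ) :
    k.factorial * ∑ t ∈ s.powersetCard k, ∏ p ∈ t, x p ≤ (∑ p ∈ s, x p) ^ k := by
  induction s using Finset.induction_on generalizing k with
  | empty =>
    cases k with
    | zero => simp
    | succ k =>
      rw [Finset.powersetCard_eq_empty.2 (by simp)]
      simp
  | insert a s ha ih =>
    cases k with
    | zero => simp
    | succ k =>
      have hs : 0 ≤ ∑ p ∈ s, x p := Finset.sum_nonneg fun p _ => hx p
      rw [Finset.powersetCard_succ_insert ha, Finset.sum_union, Finset.sum_image,
        Finset.sum_insert ha]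
      · have h1 : ∑ t ∈ s.powersetCard k, ∏ p ∈ insert a t, x p
            = x a * ∑ t ∈ s.powersetCard k, ∏ p ∈ t, x p := by
          rw [Finset.mul_sum]
          refine Finset.sum_congr rfl fun t ht => Finset.prod_insert fun hat => ha ?_
          exact (Finset.mem_powersetCard.1 ht).1 hat
        have h2 := ih (k + 1)
        have h3 := mul_le_mul_of_nonneg_left (ih k)
          (mul_nonneg (Nat.cast_nonneg (α := ℝ) (k + 1)) (hx a))
        have h4 : ∀ u : ℝ, 0 ≤ u → ∀ j : ℕ,
            u ^ (j + 1) + (j + 1 : ℕ) * x a * u ^ j ≤ (x a + u) ^ (j + 1) := by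
          intro u hu j
          induction j with
          | zero => simp [add_comm]
          | succ j ihj =>
            have h5 := mul_le_mul_of_nonneg_right ihj (add_nonneg (hx a) hu)
            have h6 : 0 ≤ (j + 1 : ℕ) * x a * u ^ j * x a := by
              have := hx a
              positivity
            rw [pow_succ (x a + u)]
            refine le_trans ?_ h5
            push_cast at h6 ⊢
            ring_nf at h6 ⊢
            linarith
        refine le_trans ?_ (h4 _ hs k)
        rw [h1, Nat.factorial_succ] at *
        push_cast at *
        linarith
      · intro t ht t' ht' h
        have e : ∀ t ∈ s.powersetCard k, (insert a t).erase a = t := fun t ht =>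
          Finset.erase_insert fun hat => ha ((Finset.mem_powersetCard.1 ht).1 hat)
        rw [← e t ht, ← e t' ht']
        exact congrArg (fun u => Finset.erase u a) h
      · rw [Finset.disjoint_left]
        intro t ht ht'
        obtain ⟨u, _, rfl⟩ := Finset.mem_image.1 ht'
        exact ha ((Finset.mem_powersetCard.1 ht).1 (Finset.mem_insert_self a u))

lemma sum_inv_primesLE_two_pow_le (J : ℕ) :
    ∑ p ∈ Nat.primesLE (2 ^ (J + 1)), (1 : ℝ) / p ≤ 1 / 2 + 4 * (harmonic J : ℝ) := by
  induction J with
  | zero =>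
    have : Nat.primesLE (2 ^ (0 + 1)) = {2} := by decide
    rw [this]; simp
  | succ J ih =>
    have hsub : Nat.primesLE (2 ^ (J + 1)) ⊆ Nat.primesLE (2 ^ (J + 1 + 1)) := by
      intro p hp
      rw [Nat.mem_primesLE] at hp ⊢
      exact ⟨hp.1.trans (Nat.pow_le_pow_right (by norm_num) (by omega)), hp.2⟩
    rw [← Finset.sum_sdiff hsub, harmonic_succ]
    have hl : 0 < Real.log 2 := Real.log_pos (by norm_num)
    set D : ℝ := 2 ^ (J + 1) * ((J + 1) * Real.log 2) with hD
    have hDpos : 0 < D := by positivity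
    have key : ∑ p ∈ Nat.primesLE (2 ^ (J + 1 + 1)) \ Nat.primesLE (2 ^ (J + 1)), (1 : ℝ) / p
        ≤ 4 * (1 / ((J : ℝ) + 1)) := by
      calc _ ≤ ∑ p ∈ Nat.primesLE (2 ^ (J + 1 + 1)) \ Nat.primesLE (2 ^ (J + 1)),
            Real.log p / D := by
            refine Finset.sum_le_sum fun p hp => ?_
            rw [Finset.mem_sdiff, Nat.mem_primesLE, Nat.mem_primesLE] at hp
            have h1 : 2 ^ (J + 1) < p := by
              by_contra h
              exact hp.2 ⟨not_lt.1 h, hp.1.2⟩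
            have h2 : (2 : ℝ) ^ (J + 1) ≤ p := by exact_mod_cast h1.le
            have h3 : (J + 1) * Real.log 2 ≤ Real.log p := by
              have := Real.log_le_log (by positivity) h2
              rwa [Real.log_pow, Nat.cast_succ] at this
            have hp0 : (0 : ℝ) < p := by exact_mod_cast hp.1.2.pos
            rw [div_le_div_iff₀ hp0 hDpos, one_mul, mul_comm (Real.log _)]
            exact mul_le_mul h2 h3 (by positivity) hp0.le
        _ ≤ ∑ p ∈ Nat.primesLE (2 ^ (J + 1 + 1)), Real.log p / D :=
            Finset.sum_le_sum_of_subset_of_nonneg Finset.sdiff_subset fun p _ _ =>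
              div_nonneg (Real.log_natCast_nonneg p) hDpos.le
        _ = Chebyshev.theta ((2 ^ (J + 1 + 1) : ℕ) : ℝ) / D := by
            rw [Chebyshev.theta_eq_sum_primesLE_log, Finset.sum_div]
        _ ≤ (Real.log 4 * ((2 ^ (J + 1 + 1) : ℕ) : ℝ)) / D := by
            gcongr
            exact Chebyshev.theta_le_log4_mul_x (by positivity)
        _ = 4 * (1 / ((J : ℝ) + 1)) := by
            have : Real.log 4 = 2 * Real.log 2 := by
              rw [show (4 : ℝ) = 2 ^ 2 by norm_num, Real.log_pow]; norm_num
            rw [this, hD]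
            push_cast
            field_simp
            ring
    push_cast
    rw [inv_eq_one_div]
    linarith

lemma sum_inv_primesLE_le :
    ∃ A > (0 : ℝ), ∀ᶠ N : ℕ in atTop,
      ∑ p ∈ Nat.primesLE N, (1 : ℝ) / p ≤ A * Real.log (Real.log N) := by
  have hlim : Tendsto (fun N : ℕ => Real.log (Real.log (N : ℝ))) atTop atTop :=
    Real.tendsto_log_atTop.comp (Real.tendsto_log_atTop.comp tendsto_natCast_atTop_atTop)
  refine ⟨10, by norm_num, ?_⟩
  filter_upwards [hlim.eventually_ge_atTop 2, eventually_ge_atTop 3] with N hL hN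
  have h1 : N ≤ 2 ^ (Nat.log 2 N + 1) := (Nat.lt_pow_succ_log_self (by norm_num) N).le
  have hsub : Nat.primesLE N ⊆ Nat.primesLE (2 ^ (Nat.log 2 N + 1)) := by
    intro p hp
    rw [Nat.mem_primesLE] at hp ⊢
    exact ⟨hp.1.trans h1, hp.2⟩
  have h2 := (Finset.sum_le_sum_of_subset_of_nonneg hsub
    (f := fun p : ℕ => (1 : ℝ) / p) fun p _ _ => by positivity).trans (sum_inv_primesLE_two_pow_le _)
  have h3 := harmonic_le_one_add_log (Nat.log 2 N)
  have hlog2 : Nat.log 2 N ≠ 0 := (Nat.log_pos (by norm_num) (by omega)).ne'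
  have h4 : (Nat.log 2 N : ℝ) ≤ 2 * Real.log N := by
    have h5 : (2 : ℝ) ^ Nat.log 2 N ≤ N := by
      exact_mod_cast Nat.pow_log_le_self 2 (by omega)
    have h6 := Real.log_le_log (by positivity) h5
    rw [Real.log_pow] at h6
    have := Real.log_two_gt_d9
    nlinarith [Nat.cast_nonneg (α := ℝ) (Nat.log 2 N)]
  have hlogN : 0 < Real.log N := Real.log_pos (by exact_mod_cast (by omega : 1 < N))
  have h7 : Real.log (Nat.log 2 N) ≤ Real.log 2 + Real.log (Real.log N) := by
    rw [← Real.log_mul (by norm_num) hlogN.ne']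
    exact Real.log_le_log (by positivity) h4
  have := Real.log_two_lt_d9
  linarith

/-- The monic polynomial `X^n + b_{n-1}X^{n-1} + ⋯ + b_0` over a commutative ring. -/
def monicPoly {R : Type*} [CommRing R] {n : ℕ} (b : Fin n → R) : R[X] :=
  X ^ n + ∑ i : Fin n, C (b i) * X ^ (i : ℕ)

/-- The resultant of `monicPoly b` and its derivative, which is its discriminant up to sign. -/
def derivResultant {R : Type*} [CommRing R] {n : ℕ} (b : Fin n → R) : R :=
  resultant (monicPoly b) (derivative (monicPoly b)) n (n - 1)

section MonicPoly

variable {R : Type*} [CommRing R] {n : ℕ}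

lemma intPoly_eq_monicPoly (a : Fin n → ℤ) : intPoly n a = monicPoly a := rfl

lemma monic_monicPoly (b : Fin n → R) : (monicPoly b).Monic :=
  monic_X_pow_add (degree_sum_fin_lt b)

lemma natDegree_monicPoly [Nontrivial R] (b : Fin n → R) : (monicPoly b).natDegree = n := by
  rw [monicPoly, natDegree_add_eq_left_of_degree_lt, natDegree_X_pow]
  rw [degree_X_pow]
  exact degree_sum_fin_lt b

lemma coeff_monicPoly_self (b : Fin n → R) : (monicPoly b).coeff n = 1 := by
  rw [monicPoly, coeff_add, coeff_X_pow_self, coeff_eq_zero_of_degree_lt (degree_sum_fin_lt b),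
    add_zero]

lemma coeff_monicPoly (b : Fin n → R) (i : Fin n) : (monicPoly b).coeff i = b i := by
  rw [monicPoly, coeff_add, coeff_X_pow, if_neg i.2.ne, zero_add, finsetSum_coeff,
    Finset.sum_eq_single i]
  · simp
  · intro j _ hj
    rw [coeff_C_mul, coeff_X_pow, if_neg fun h => hj (Fin.ext h.symm), mul_zero]
  · simp

lemma map_monicPoly {S : Type*} [CommRing S] (φ : R →+* S) (b : Fin n → R) :
    (monicPoly b).map φ = monicPoly fun i => φ (b i) := by
  simp [monicPoly, Polynomial.map_sum]

lemma map_derivResultant {S : Type*} [CommRing S] (φ : R →+* S) (b : Fin n → R) :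
    φ (derivResultant b) = derivResultant fun i => φ (b i) := by
  rw [derivResultant, derivResultant, ← map_monicPoly, derivative_map, resultant_map_map]

lemma derivResultant_eq_resultant [Nontrivial R] (b : Fin n → R) :
    derivResultant b = resultant (monicPoly b) (derivative (monicPoly b)) := by
  have h : (derivative (monicPoly b)).natDegree ≤ n - 1 := by
    simpa [natDegree_monicPoly] using natDegree_derivative_le (monicPoly b)
  obtain ⟨k, hk⟩ := Nat.exists_eq_add_of_le h
  rw [derivResultant, hk, resultant_add_right_deg _ _ _ _ _ le_rfl, coeff_monicPoly_self, one_pow,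
    one_mul, natDegree_monicPoly]

lemma derivResultant_eq_zero_iff {K : Type*} [Field K] (b : Fin n → K) :
    derivResultant b = 0 ↔ ¬ (monicPoly b).Separable := by
  rw [derivResultant_eq_resultant, resultant_eq_zero_iff, Polynomial.Separable]
  exact and_iff_right (Or.inl (monic_monicPoly b).ne_zero)

end MonicPoly

lemma derivResultant_ne_zero {n : ℕ} (a : Fin n → ℤ) (h : Irreducible (ratPoly n a)) :
    derivResultant a ≠ 0 := by
  intro h0
  have h1 := map_derivResultant (Int.castRingHom ℚ) a
  rw [h0, map_zero] at h1
  refine (derivResultant_eq_zero_iff _).1 h1.symm ?_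
  rw [← map_monicPoly]
  exact h.separable

lemma abs_derivResultant_le {n N : ℕ} (hn : 1 ≤ n) (hN : 1 ≤ N) (a : Fin n → ℤ)
    (ha : a ∈ coeffBox n N) :
    |derivResultant a| ≤ (n + (n - 1)).factorial * (n * N : ℤ) ^ (n + (n - 1)) := by
  have hNn : (1 : ℤ) ≤ N := by exact_mod_cast hN
  have hn' : (1 : ℤ) ≤ n := by exact_mod_cast hn
  have hc : ∀ j, |(monicPoly a).coeff j| ≤ N := by
    intro j
    rcases lt_trichotomy j n with hj | hj | hj
    · rw [coeff_monicPoly a ⟨j, hj⟩]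
      have := Fintype.mem_piFinset.1 ha ⟨j, hj⟩
      rw [Finset.mem_Icc] at this
      exact abs_le.2 this
    · rw [hj, coeff_monicPoly_self]
      simpa using hNn
    · rw [coeff_eq_zero_of_natDegree_lt (by rwa [natDegree_monicPoly])]
      simp
  have hd : ∀ j, |(derivative (monicPoly a)).coeff j| ≤ n * N := by
    intro j
    by_cases hj : j + 1 ≤ n
    · rw [coeff_derivative, abs_mul, mul_comm]
      have h1 : |(j : ℤ) + 1| ≤ n := by
        rw [abs_of_nonneg (by positivity)]
        exact_mod_cast hj
      exact mul_le_mul h1 (hc _) (abs_nonneg _) (by positivity)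
    · rw [coeff_derivative, coeff_eq_zero_of_natDegree_lt (by rw [natDegree_monicPoly]; omega)]
      simp only [zero_mul, abs_zero]
      positivity
  have hc' : ∀ j, |(monicPoly a).coeff j| ≤ n * N := fun j =>
    (hc j).trans (le_mul_of_one_le_left (by positivity) hn')
  have h0 : (0 : ℤ) ≤ n * N := by positivity
  have := Matrix.det_le (abv := AbsoluteValue.abs) (x := (n * N : ℤ))
    (A := sylvester (monicPoly a) (derivative (monicPoly a)) n (n - 1)) (by
      intro i j
      rw [AbsoluteValue.abs_apply, sylvester, Matrix.of_apply]
      induction j using Fin.addCases with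
      | left j =>
        rw [Fin.addCases_left]
        split_ifs
        · exact hd _
        · simpa using h0
      | right j =>
        rw [Fin.addCases_right]
        split_ifs
        · exact hc' _
        · simpa using h0)
  simpa [derivResultant, resultant] using this

lemma discr_dvd_derivResultant_pow {K : Type*} [Field K] [NumberField K] {n : ℕ} (hn : 1 ≤ n)
    (a : Fin n → ℤ) (α : K) (hα : aeval α (intPoly n a) = 0)
    (hirr : Irreducible (ratPoly n a)) (htop : Algebra.adjoin ℚ {α} = ⊤) :
    (NumberField.discr K).natAbs ∣ (derivResultant a).natAbs ^ Module.finrank ℚ K := by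
  have hint : IsIntegral ℤ α := ⟨intPoly n a, monic_monicPoly a, by rwa [← aeval_def]⟩
  let x : NumberField.RingOfIntegers K := ⟨α, hint⟩
  have hx : aeval x (intPoly n a) = 0 := by
    apply NumberField.RingOfIntegers.coe_injective
    have := aeval_algebraMap_apply K x (intPoly n a)
    rw [map_zero]
    exact this.symm.trans hα
  have hmin : minpoly ℤ x = intPoly n a := by
    have h1 : minpoly ℚ α = ratPoly n a := by
      symm
      refine minpoly.eq_of_irreducible_of_monic hirr ?_ ((monic_monicPoly a).map _)
      rw [ratPoly]
      exact (aeval_map_algebraMap ℚ α _).trans hα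
    have h2 := minpoly.isIntegrallyClosed_eq_field_fractions' ℚ hint
    have h3 : minpoly ℤ x = minpoly ℤ α :=
      (minpoly.algebraMap_eq NumberField.RingOfIntegers.coe_injective x).symm
    rw [h3]
    apply Polynomial.map_injective (algebraMap ℤ ℚ) Int.cast_injective
    rw [← h2, h1]
    rfl
  have hmem := aeval_derivative_mem_differentIdeal ℤ ℚ K x htop
  rw [hmin] at hmem
  have hdeg : (derivative (intPoly n a)).natDegree ≤ n - 1 := by
    have := natDegree_derivative_le (intPoly n a)
    rwa [intPoly_eq_monicPoly, natDegree_monicPoly] at this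
  obtain ⟨p, q, -, -, hpq⟩ := exists_mul_add_mul_eq_C_resultant (m := n) (n := n - 1)
    (intPoly n a) (derivative (intPoly n a)) (natDegree_monicPoly a).le hdeg (Or.inl (by omega))
  have hR : ((derivResultant a : ℤ) : NumberField.RingOfIntegers K)
      ∈ differentIdeal ℤ (NumberField.RingOfIntegers K) := by
    have := congrArg (aeval x) hpq
    rw [map_add, map_mul, map_mul, hx, zero_mul, zero_add, aeval_C] at this
    have h' := Ideal.mul_mem_right (aeval x q) _ hmem
    rw [this] at h'
    simpa [derivResultant, intPoly_eq_monicPoly] using h'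
  have h := Ideal.absNorm_dvd_norm_of_mem hR
  rw [NumberField.absNorm_differentIdeal K] at h
  have h2 : Algebra.norm ℤ ((derivResultant a : ℤ) : NumberField.RingOfIntegers K)
      = derivResultant a ^ Module.finrank ℚ K := by
    rw [← NumberField.RingOfIntegers.rank K,
      Module.finrank_eq_card_basis (NumberField.RingOfIntegers.basis K)]
    exact Algebra.norm_algebraMap_of_basis (NumberField.RingOfIntegers.basis K) (derivResultant a)
  rw [h2] at h
  rw [← Int.natAbs_pow]
  exact Int.natCast_dvd.1 h

lemma primeFactors_fieldDisc_subset {n : ℕ} (hn : 1 ≤ n) (a : Fin n → ℤ)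
    (hirr : Irreducible (ratPoly n a)) :
    (fieldDisc n a).natAbs.primeFactors ⊆ (derivResultant a).natAbs.primeFactors := by
  have : Fact (Irreducible (ratPoly n a)) := ⟨hirr⟩
  have : CharZero (AdjoinRoot (ratPoly n a)) :=
    charZero_of_injective_algebraMap (algebraMap ℚ (AdjoinRoot (ratPoly n a))).injective
  have : FiniteDimensional ℚ (AdjoinRoot (ratPoly n a)) :=
    PowerBasis.finite (AdjoinRoot.powerBasis hirr.ne_zero)
  have : NumberField (AdjoinRoot (ratPoly n a)) := ⟨⟩
  have hdvd := discr_dvd_derivResultant_pow hn a (AdjoinRoot.root (ratPoly n a))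
    (by
      rw [← aeval_map_algebraMap ℚ]
      exact AdjoinRoot.eval₂_root (ratPoly n a)) hirr AdjoinRoot.adjoinRoot_eq_top
  have hf : fieldDisc n a = NumberField.discr (AdjoinRoot (ratPoly n a)) := by
    rw [fieldDisc, dif_pos hirr]
  intro p hp
  rw [hf] at hp
  have hp' := Nat.prime_of_mem_primeFactors hp
  exact Nat.mem_primeFactors.2 ⟨hp', hp'.dvd_of_dvd_pow
    ((Nat.dvd_of_mem_primeFactors hp).trans hdvd), Int.natAbs_ne_zero.2
    (derivResultant_ne_zero a hirr)⟩

lemma coeff_zero_eq_neg_eval {K : Type*} [Field K] {m : ℕ} (b : Fin (m + 1) → K) (β : K)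
    (h : (monicPoly b).eval β = 0) :
    b 0 = -(monicPoly (Fin.cons 0 (Fin.tail b) : Fin (m + 1) → K)).eval β := by
  simp only [monicPoly, eval_add, eval_pow, eval_X, eval_finsetSum, eval_mul, eval_C,
    Fin.sum_univ_succ, Fin.cons_zero, Fin.cons_succ, Fin.tail, Fin.val_zero, pow_zero, mul_one] at h ⊢
  linear_combination h

lemma derivative_monicPoly_cons {R : Type*} [CommRing R] {m : ℕ} (b : Fin (m + 1) → R) :
    derivative (monicPoly b) =
      derivative (monicPoly (Fin.cons 0 (Fin.tail b) : Fin (m + 1) → R)) := by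
  simp [monicPoly, Fin.sum_univ_succ, Fin.tail]

/-- At most `n * p ^ (n - 1)` monic polynomials of degree `n` over `𝔽_p` are inseparable. -/
lemma exists_finset_derivResultant_eq_zero {n : ℕ} (hn : 1 ≤ n) (p : ℕ) :
    ∃ B : Finset (Fin n → ZMod p), p.Prime →
      B.card ≤ n * p ^ (n - 1) ∧ ∀ b, derivResultant b = 0 → b ∈ B := by
  by_cases hp : p.Prime
  swap
  · exact ⟨∅, fun h => absurd h hp⟩
  have : Fact p.Prime := ⟨hp⟩
  obtain ⟨m, rfl⟩ : ∃ m, n = m + 1 := ⟨n - 1, by omega⟩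
  refine ⟨Finset.univ.filter fun b => derivResultant b = 0, fun _ => ⟨?_, by simp⟩⟩
  by_cases hpn : p ∣ m + 1
  · refine (Finset.card_le_univ _).trans ?_
    rw [Fintype.card_fun, ZMod.card, Fintype.card_fin, pow_succ', Nat.add_sub_cancel]
    exact Nat.mul_le_mul_right _ (Nat.le_of_dvd (by omega) hpn)
  have hcard : (Finset.univ : Finset (Fin m → ZMod p)).card = p ^ (m + 1 - 1) := by
    simp [ZMod.card]
  rw [← hcard]
  refine Finset.card_le_mul_card_image_of_maps_to (f := Fin.tail) (fun _ _ => Finset.mem_univ _)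
    _ fun c _ => ?_
  let F := AlgebraicClosure (ZMod p)
  let φ := algebraMap (ZMod p) F
  let g : F[X] := monicPoly (fun i => φ ((Fin.cons 0 c : Fin (m + 1) → ZMod p) i))
  have hφ : ∀ b : Fin (m + 1) → ZMod p, Fin.tail b = c →
      (Fin.cons 0 (Fin.tail fun i => φ (b i)) : Fin (m + 1) → F) =
        fun i => φ ((Fin.cons 0 c : Fin (m + 1) → ZMod p) i) := by
    intro b hb
    funext i
    refine Fin.cases ?_ (fun j => ?_) i
    · simp
    · rw [Fin.cons_succ, Fin.cons_succ, ← hb]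
      rfl
  have hg' : derivative g ≠ 0 := by
    intro h0
    have := congrArg (fun q => coeff q m) h0
    simp only [coeff_derivative, g, coeff_monicPoly_self, one_mul, coeff_zero] at this
    apply hpn
    rw [← CharP.cast_eq_zero_iff F p]
    exact_mod_cast this
  have hdeg : (derivative g).natDegree ≤ m := by
    have := natDegree_derivative_le g
    rwa [natDegree_monicPoly, Nat.add_sub_cancel] at this
  have hle : (((derivative g).roots.toFinset).image fun β => -g.eval β).card ≤ m + 1 :=
    (Finset.card_image_le.trans (Multiset.toFinset_card_le _)).trans
      (((card_roots' _).trans hdeg).trans (Nat.le_succ m))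
  refine le_trans (Finset.card_le_card_of_injOn (fun b => φ (b 0)) ?_ ?_) hle
  · intro b hb
    rw [Finset.mem_coe, Finset.mem_filter, Finset.mem_filter] at hb
    obtain ⟨⟨-, hb0⟩, hbc⟩ := hb
    have h1 := map_derivResultant φ b
    rw [hb0, map_zero, eq_comm, derivResultant_eq_zero_iff] at h1
    have h2 : ¬ IsCoprime (monicPoly fun i => φ (b i)) (derivative (monicPoly fun i => φ (b i))) :=
      h1
    rw [isCoprime_iff_aeval_ne_zero_of_isAlgClosed F F] at h2
    push Not at h2
    obtain ⟨β, hβ, hβ'⟩ := h2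
    rw [coe_aeval_eq_eval] at hβ hβ'
    rw [derivative_monicPoly_cons, hφ b hbc] at hβ'
    have h3 := coeff_zero_eq_neg_eval _ β hβ
    rw [hφ b hbc] at h3
    rw [Finset.mem_coe, Finset.mem_image]
    exact ⟨β, by rw [Multiset.mem_toFinset, mem_roots hg']; exact hβ', h3.symm⟩
  · intro b hb b' hb' h
    rw [Finset.mem_coe, Finset.mem_filter] at hb hb'
    have h0 : b 0 = b' 0 := φ.injective h
    rw [← Fin.cons_self_tail b, ← Fin.cons_self_tail b', h0, hb.2, hb'.2]

lemma card_Icc_modEq_le {N m : ℕ} (hm : 0 < m) (hmN : m ≤ N) (v : ℤ) :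
    (((Finset.Icc (-(N : ℤ)) N).filter fun x => x ≡ v [ZMOD m]).card : ℝ) ≤ 4 * N / m := by
  have hI : Finset.Icc (-(N : ℤ)) N = Finset.Ioc (-(N : ℤ) - 1) N := by
    ext x
    rw [Finset.mem_Icc, Finset.mem_Ioc]
    omega
  have h := Int.Ioc_filter_modEq_card (-(N : ℤ) - 1) N (r := m) (by exact_mod_cast hm) v
  have hm1 : (1 : ℚ) ≤ m := by exact_mod_cast hm
  have hmN' : (m : ℚ) ≤ N := by exact_mod_cast hmN
  have key : (((Finset.Ioc (-(N : ℤ) - 1) N).filter fun x => x ≡ v [ZMOD m]).card : ℚ)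
      ≤ 4 * N / m := by
    have h' : (((Finset.Ioc (-(N : ℤ) - 1) N).filter fun x => x ≡ v [ZMOD m]).card : ℚ) =
        ((max (⌊((N : ℤ) - v) / ((m : ℤ) : ℚ)⌋ - ⌊((-(N : ℤ) - 1 : ℤ) - v) / ((m : ℤ) : ℚ)⌋) 0
          : ℤ) : ℚ) := by
      rw [← h]
      push_cast
      congr
    rw [h']
    push_cast
    refine max_le ?_ (by positivity)
    have h1 := Int.floor_le (((N : ℚ) - v) / m)
    have h2 := Int.lt_floor_add_one ((-(N : ℚ) - 1 - v) / m)
    have h3 : ((N : ℚ) - v) / m - (-(N : ℚ) - 1 - v) / m = (2 * N + 1) / m := by ring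
    have h4 : (2 * N + 1 : ℚ) / m + 1 ≤ 4 * N / m := by
      rw [div_add_one (by positivity)]
      gcongr
      linarith
    linarith
  rw [hI]
  have := (Rat.cast_le (K := ℝ)).2 key
  push_cast at this
  exact this

lemma card_coeffBox_reduction_le {n N : ℕ} (S : Finset ℕ) (hS : ∀ p ∈ S, p.Prime)
    (hm : ∏ p ∈ S, p ≤ N) (B : ∀ p : ℕ, Finset (Fin n → ZMod p)) :
    (((coeffBox n N).filter fun a => ∀ p ∈ S, (fun i => (a i : ZMod p)) ∈ B p).card : ℝ) ≤
      (∏ p ∈ S, ((B p).card : ℝ)) * (4 * N / (∏ p ∈ S, p : ℕ)) ^ n := by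
  have hpos : 0 < ∏ p ∈ S, p := Finset.prod_pos fun p hp => (hS p hp).pos
  set m := ∏ p ∈ S, p with hmdef
  let T := Fintype.piFinset fun p : S => B p
  have hT : (T.card : ℝ) = ∏ p ∈ S, ((B p).card : ℝ) := by
    rw [Fintype.card_piFinset, Nat.cast_prod]
    exact Finset.prod_coe_sort S fun p => ((B p).card : ℝ)
  let Φ : (Fin n → ℤ) → ∀ p : S, Fin n → ZMod p := fun a p i => (a i : ZMod p)
  have hmaps : ∀ a ∈ (coeffBox n N).filter fun a => ∀ p ∈ S, (fun i => (a i : ZMod p)) ∈ B p,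
      Φ a ∈ T := fun a ha => Fintype.mem_piFinset.2 fun p => (Finset.mem_filter.1 ha).2 p p.2
  rw [Finset.card_eq_sum_card_fiberwise hmaps, ← hT, Nat.cast_sum, ← nsmul_eq_mul]
  refine Finset.sum_le_card_nsmul _ _ _ fun t _ => ?_
  rcases Finset.eq_empty_or_nonempty (((coeffBox n N).filter fun a =>
    ∀ p ∈ S, (fun i => (a i : ZMod p)) ∈ B p).filter fun a => Φ a = t) with h0 | ⟨a₀, ha₀⟩
  · rw [h0, Finset.card_empty, Nat.cast_zero]
    positivity
  have hsub : (((coeffBox n N).filter fun a =>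
      ∀ p ∈ S, (fun i => (a i : ZMod p)) ∈ B p).filter fun a => Φ a = t) ⊆
      Fintype.piFinset fun i => (Finset.Icc (-(N : ℤ)) N).filter fun x => x ≡ a₀ i [ZMOD m] := by
    intro a ha
    rw [Finset.mem_filter, Finset.mem_filter] at ha ha₀
    rw [Fintype.mem_piFinset]
    intro i
    rw [Finset.mem_filter]
    refine ⟨Fintype.mem_piFinset.1 ha.1.1 i, (Int.modEq_iff_dvd.2 ?_)⟩
    rw [hmdef, Nat.cast_prod]
    refine Finset.prod_dvd_of_coprime ?_ fun p hp => ?_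
    · intro p hp q hq hpq
      exact Nat.isCoprime_iff_coprime.2 ((Nat.coprime_primes (hS p hp) (hS q hq)).2 hpq)
    · have h1 := congrFun (congrFun (ha.2.trans ha₀.2.symm) ⟨p, hp⟩) i
      exact Int.modEq_iff_dvd.1 ((ZMod.intCast_eq_intCast_iff _ _ _).1 h1)
  calc _ ≤ ((Fintype.piFinset fun i => (Finset.Icc (-(N : ℤ)) N).filter
        fun x => x ≡ a₀ i [ZMOD m]).card : ℝ) := by exact_mod_cast Finset.card_le_card hsub
    _ = ∏ i : Fin n, (((Finset.Icc (-(N : ℤ)) N).filter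
        fun x => x ≡ a₀ i [ZMOD m]).card : ℝ) := by
        rw [Fintype.card_piFinset, Nat.cast_prod]
    _ ≤ ∏ _i : Fin n, (4 * (N : ℝ) / m) :=
        Finset.prod_le_prod (fun _ _ => by positivity) fun i _ => card_Icc_modEq_le hpos hm _
    _ = _ := by rw [Finset.prod_const, Finset.card_univ, Fintype.card_fin]

lemma card_coeffBox_forall_dvd_le {n N : ℕ} (hn : 1 ≤ n) (S : Finset ℕ)
    (hS : ∀ p ∈ S, p.Prime) (hm : ∏ p ∈ S, p ≤ N) :
    (((coeffBox n N).filter fun a => ∀ p ∈ S, (p : ℤ) ∣ derivResultant a).card : ℝ) ≤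
      (4 * N) ^ n * n ^ S.card * ∏ p ∈ S, (1 : ℝ) / p := by
  choose B hB using fun p : ℕ => exists_finset_derivResultant_eq_zero hn p
  have hsub : ((coeffBox n N).filter fun a => ∀ p ∈ S, (p : ℤ) ∣ derivResultant a) ⊆
      (coeffBox n N).filter fun a => ∀ p ∈ S, (fun i => (a i : ZMod p)) ∈ B p := by
    intro a ha
    rw [Finset.mem_filter] at ha ⊢
    refine ⟨ha.1, fun p hp => (hB p (hS p hp)).2 _ ?_⟩
    have := map_derivResultant (Int.castRingHom (ZMod p)) a
    rw [eq_intCast, (ZMod.intCast_zmod_eq_zero_iff_dvd _ _).2 (ha.2 p hp)] at this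
    exact this.symm
  calc _ ≤ (((coeffBox n N).filter fun a =>
          ∀ p ∈ S, (fun i => (a i : ZMod p)) ∈ B p).card : ℝ) := by
        exact_mod_cast Finset.card_le_card hsub
    _ ≤ (∏ p ∈ S, ((B p).card : ℝ)) * (4 * N / (∏ p ∈ S, p : ℕ)) ^ n :=
        card_coeffBox_reduction_le S hS hm B
    _ ≤ (∏ p ∈ S, ((n : ℝ) * p ^ (n - 1))) * (4 * N / (∏ p ∈ S, p : ℕ)) ^ n := by
        gcongr with p hp
        exact_mod_cast (hB p (hS p hp)).1
    _ = (4 * N) ^ n * n ^ S.card * ∏ p ∈ S, (1 : ℝ) / p := by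
        have hpos : (0 : ℝ) < ∏ p ∈ S, (p : ℝ) :=
          Finset.prod_pos fun p hp => by exact_mod_cast (hS p hp).pos
        obtain ⟨m, rfl⟩ : ∃ m, n = m + 1 := ⟨n - 1, by omega⟩
        rw [Finset.prod_mul_distrib, Finset.prod_const, Finset.prod_pow, Finset.prod_div_distrib,
          Finset.prod_const_one, Nat.add_sub_cancel, Nat.cast_prod, div_pow]
        field_simp
        ring

/-- Double counting: the `k`-th binomial moment of the number of primes `p` with `p ^ k ≤ N`
dividing the discriminant. -/
lemma sum_choose_card_primes_dvd_le {n N k : ℕ} (hn : 1 ≤ n) (hk : 1 ≤ k) :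
    (k.factorial : ℝ) * ∑ a ∈ coeffBox n N, ((((Nat.primesLE N).filter
        fun p => p ^ k ≤ N ∧ (p : ℤ) ∣ derivResultant a).card.choose k : ℕ) : ℝ) ≤
      (4 * N) ^ n * (n * ∑ p ∈ Nat.primesLE N, (1 : ℝ) / p) ^ k := by
  set T := (Nat.primesLE N).filter fun p => p ^ k ≤ N
  have hT' : ∀ a : Fin n → ℤ, ((Nat.primesLE N).filter
      fun p => p ^ k ≤ N ∧ (p : ℤ) ∣ derivResultant a) =
      T.filter fun p : ℕ => (p : ℤ) ∣ derivResultant a := fun a => (Finset.filter_filter _ _ _).symm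
  have h1 : ∑ a ∈ coeffBox n N, ((((Nat.primesLE N).filter
        fun p => p ^ k ≤ N ∧ (p : ℤ) ∣ derivResultant a).card.choose k : ℕ) : ℝ) =
      ∑ S ∈ T.powersetCard k,
        (((coeffBox n N).filter fun a => ∀ p ∈ S, (p : ℤ) ∣ derivResultant a).card : ℝ) := by
    have h2 := Finset.sum_card_bipartiteAbove_eq_sum_card_bipartiteBelow
      (s := coeffBox n N) (t := T.powersetCard k)
      fun (a : Fin n → ℤ) (S : Finset ℕ) => ∀ p ∈ S, (p : ℤ) ∣ derivResultant a
    rw [← Nat.cast_sum, ← Nat.cast_sum]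
    refine congrArg _ (Eq.trans (Finset.sum_congr rfl fun a _ => ?_) h2)
    rw [← Finset.card_powersetCard, hT']
    congr 1
    ext S
    simp only [Finset.bipartiteAbove, Finset.mem_filter, Finset.mem_powersetCard]
    constructor
    · rintro ⟨hS, hc⟩
      exact ⟨⟨fun p hp => (Finset.mem_filter.1 (hS hp)).1, hc⟩,
        fun p hp => (Finset.mem_filter.1 (hS hp)).2⟩
    · rintro ⟨⟨hS, hc⟩, hd⟩
      exact ⟨fun p hp => Finset.mem_filter.2 ⟨hS hp, hd p hp⟩, hc⟩
  have h3 : ∀ S ∈ T.powersetCard k,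
      (((coeffBox n N).filter fun a => ∀ p ∈ S, (p : ℤ) ∣ derivResultant a).card : ℝ) ≤
        (4 * N) ^ n * n ^ k * ∏ p ∈ S, (1 : ℝ) / p := by
    intro S hS
    rw [Finset.mem_powersetCard] at hS
    have hmem : ∀ p ∈ S, p.Prime ∧ p ^ k ≤ N := fun p hp => by
      have := Finset.mem_filter.1 (hS.1 hp)
      exact ⟨(Nat.mem_primesLE.1 this.1).2, this.2⟩
    have h := card_coeffBox_forall_dvd_le (N := N) hn S (fun p hp => (hmem p hp).1) (by
      refine (Nat.pow_le_pow_iff_left (n := k) (by omega)).1 ?_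
      rw [← Finset.prod_pow]
      refine (Finset.prod_le_pow_card S _ N fun p hp => (hmem p hp).2).trans ?_
      rw [hS.2])
    rwa [hS.2] at h
  rw [h1]
  calc _ ≤ (k.factorial : ℝ) * ∑ S ∈ T.powersetCard k,
        ((4 * N) ^ n * n ^ k * ∏ p ∈ S, (1 : ℝ) / p) := by
        gcongr with S hS
        exact h3 S hS
    _ = (4 * N) ^ n * n ^ k *
        (k.factorial * ∑ S ∈ T.powersetCard k, ∏ p ∈ S, (1 : ℝ) / p) := by
        rw [← Finset.mul_sum]
        ring
    _ ≤ (4 * N) ^ n * n ^ k * (∑ p ∈ T, (1 : ℝ) / p) ^ k := by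
        gcongr
        exact factorial_mul_sum_powersetCard_prod_le (fun p : ℕ => (1 : ℝ) / p)
          (fun p => by positivity) T k
    _ ≤ (4 * N) ^ n * n ^ k * (∑ p ∈ Nat.primesLE N, (1 : ℝ) / p) ^ k := by
        gcongr
        exact Finset.filter_subset _ _
    _ = _ := by rw [mul_pow (n : ℝ), mul_assoc]

/-- Few primes `p` with `p ^ k > N` divide a nonzero integer of size at most `N ^ b`. -/
lemma card_large_primeFactors_le {M N b k : ℕ} (hM : M ≠ 0) (hN : 2 ≤ N)
    (hMN : M ≤ N ^ b) :
    (M.primeFactors.filter fun p => ¬ p ^ k ≤ N).card ≤ b * k := by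
  refine (Nat.pow_le_pow_iff_right (a := N) (by omega)).1 ?_
  calc N ^ (M.primeFactors.filter fun p => ¬ p ^ k ≤ N).card
      ≤ ∏ p ∈ M.primeFactors.filter fun p => ¬ p ^ k ≤ N, p ^ k :=
        Finset.pow_card_le_prod _ _ _ fun p hp => (not_le.1 (Finset.mem_filter.1 hp).2).le
    _ = (∏ p ∈ M.primeFactors.filter fun p => ¬ p ^ k ≤ N, p) ^ k := Finset.prod_pow _ _ _
    _ ≤ M ^ k := by
        gcongr
        refine Nat.le_of_dvd (by omega) (dvd_trans ?_ (Nat.prod_primeFactors_dvd M))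
        exact Finset.prod_dvd_prod_of_subset _ _ _ (Finset.filter_subset _ _)
    _ ≤ (N ^ b) ^ k := by gcongr
    _ = N ^ (b * k) := (pow_mul _ _ _).symm

lemma eventually_card_many_ramified_le {n : ℕ} (hn : 1 ≤ n) {A : ℝ} (hA : 0 < A)
    (hsum : ∀ᶠ N : ℕ in atTop,
      ∑ p ∈ Nat.primesLE N, (1 : ℝ) / p ≤ A * Real.log (Real.log N)) {k : ℕ} (hk : 1 ≤ k) :
    ∀ᶠ N : ℕ in atTop, (((P0 n N).filter fun f => ¬ ((fieldDisc n f).natAbs.primeFactors.card : ℝ) ≤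
      8 * n * A * Real.log (Real.log N)).card : ℝ) ≤ 4 ^ n * (1 / 2) ^ k * (N : ℝ) ^ n := by
  have hlim : Tendsto (fun N : ℕ => Real.log (Real.log (N : ℝ))) atTop atTop :=
    Real.tendsto_log_atTop.comp (Real.tendsto_log_atTop.comp tendsto_natCast_atTop_atTop)
  have hn0 : (0 : ℝ) < n := by exact_mod_cast hn
  filter_upwards [hsum, hlim.eventually_ge_atTop 1,
    (hlim.const_mul_atTop (show 0 < 4 * n * A by positivity)).eventually_ge_atTop
      (((2 * n * k + 2 * k : ℕ) : ℝ)),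
    eventually_ge_atTop 2,
    eventually_ge_atTop ((n + (n - 1)).factorial * n ^ (n + (n - 1)))] with N hs hL hkL hN hNc
  set L := Real.log (Real.log (N : ℝ))
  set E := (P0 n N).filter fun f => ¬ ((fieldDisc n f).natAbs.primeFactors.card : ℝ) ≤
      8 * n * A * L
  set ω : (Fin n → ℤ) → ℕ := fun a => ((Nat.primesLE N).filter
        fun p => p ^ k ≤ N ∧ (p : ℤ) ∣ derivResultant a).card
  have hEbox : E ⊆ coeffBox n N :=
    (Finset.filter_subset _ _).trans (Finset.filter_subset _ _)
  have hlarge : ∀ a ∈ E, 4 * n * A * L ≤ ω a := by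
    intro a ha
    have ha' := (Finset.mem_filter.1 ha).2
    have hirr : Irreducible (ratPoly n a) := by
      by_contra h
      apply ha'
      rw [fieldDisc, dif_neg h]
      simp only [Int.natAbs_zero, Nat.primeFactors_zero, Finset.card_empty, Nat.cast_zero]
      positivity
    have hR := Int.natAbs_ne_zero.2 (derivResultant_ne_zero a hirr)
    have hbound : (derivResultant a).natAbs ≤ N ^ (2 * n) := by
      have h1 := abs_derivResultant_le hn (by omega) a (hEbox ha)
      have h2 : (derivResultant a).natAbs ≤
          (n + (n - 1)).factorial * (n * N) ^ (n + (n - 1)) := by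
        rw [Int.abs_eq_natAbs] at h1
        exact_mod_cast h1
      calc _ ≤ (n + (n - 1)).factorial * (n * N) ^ (n + (n - 1)) := h2
        _ = ((n + (n - 1)).factorial * n ^ (n + (n - 1))) * N ^ (n + (n - 1)) := by
            rw [mul_pow, mul_assoc]
        _ ≤ N * N ^ (n + (n - 1)) := by gcongr
        _ = N ^ (2 * n) := by
            rw [← pow_succ']
            congr 1
            omega
    have h1 := card_large_primeFactors_le (k := k) hR hN hbound
    have h2 : ((derivResultant a).natAbs.primeFactors.filter fun p => p ^ k ≤ N).card ≤ ω a := by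
      refine Finset.card_le_card fun p hp => ?_
      rw [Finset.mem_filter] at hp ⊢
      have hpp := Nat.prime_of_mem_primeFactors hp.1
      exact ⟨Nat.mem_primesLE.2 ⟨(Nat.le_self_pow (by omega) p).trans hp.2, hpp⟩, hp.2,
        Int.natCast_dvd.2 (Nat.dvd_of_mem_primeFactors hp.1)⟩
    have h3 := Finset.card_le_card (primeFactors_fieldDisc_subset hn a hirr)
    have h4 := Finset.card_filter_add_card_filter_not
      (s := (derivResultant a).natAbs.primeFactors) fun p => p ^ k ≤ N
    have h5 : ((fieldDisc n a).natAbs.primeFactors.card : ℝ) ≤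
        ω a + ((2 * n * k : ℕ) : ℝ) := by
      rw [← Nat.cast_add, Nat.cast_le]
      omega
    push Not at ha'
    have : ((2 * n * k : ℕ) : ℝ) ≤ 4 * n * A * L :=
      le_trans (by exact_mod_cast Nat.le_add_right _ _) hkL
    linarith
  have hchoose : ∀ a ∈ E, (2 * n * A * L) ^ k ≤ k.factorial * ((ω a).choose k : ℝ) := by
    intro a ha
    have h1 := hlarge a ha
    have h2 : 2 * k ≤ ω a := by
      have : ((2 * k : ℕ) : ℝ) ≤ ω a :=
        le_trans (by exact_mod_cast Nat.le_add_left _ _) (hkL.trans h1)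
      exact_mod_cast this
    have h3 := Nat.pow_le_choose (α := ℝ) k (ω a)
    rw [div_le_iff₀' (by positivity)] at h3
    refine le_trans ?_ h3
    refine pow_le_pow_left₀ (by positivity) ?_ k
    have h4 : (ω a : ℝ) ≤ 2 * ((ω a + 1 - k : ℕ) : ℝ) := by
      exact_mod_cast (by omega : ω a ≤ 2 * (ω a + 1 - k))
    linarith
  have hmain := sum_choose_card_primes_dvd_le (n := n) (N := N) hn hk
  have hpos : 0 < (2 * n * A * L) ^ k := by positivity
  have hcomb : (E.card : ℝ) * (2 * n * A * L) ^ k ≤ (4 * N) ^ n * (n * (A * L)) ^ k := by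
    calc (E.card : ℝ) * (2 * n * A * L) ^ k = ∑ _a ∈ E, (2 * n * A * L) ^ k := by
          rw [Finset.sum_const, nsmul_eq_mul]
      _ ≤ ∑ a ∈ E, k.factorial * ((ω a).choose k : ℝ) := Finset.sum_le_sum hchoose
      _ ≤ ∑ a ∈ coeffBox n N, k.factorial * ((ω a).choose k : ℝ) :=
          Finset.sum_le_sum_of_subset_of_nonneg hEbox fun _ _ _ => by positivity
      _ = k.factorial * ∑ a ∈ coeffBox n N, ((ω a).choose k : ℝ) := (Finset.mul_sum _ _ _).symm
      _ ≤ _ := hmain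
      _ ≤ _ := by gcongr
  have heq : (4 * (N : ℝ)) ^ n * (n * (A * L)) ^ k =
      4 ^ n * (1 / 2) ^ k * (N : ℝ) ^ n * (2 * n * A * L) ^ k := by
    rw [show (2 * n * A * L : ℝ) = 2 * (n * (A * L)) by ring, mul_pow 2, mul_pow 4, one_div,
      inv_pow]
    field_simp
  rw [heq] at hcomb
  exact le_of_mul_le_mul_right hcomb hpos

/-- **Corollary 1.5**: for almost all `f ∈ 𝒫⁰_{n,N}`, outside of a set of size `o(Nⁿ)`,
the number of ramified primes in `ℚ_f/ℚ` is `≪_n log log N`. -/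
theorem ramified_primes_almost_all (n : ℕ) (hn : 2 ≤ n) :
    ∃ C > (0 : ℝ), ∃ E : ℕ → Finset (Fin n → ℤ),
      (∀ N, E N ⊆ P0 n N) ∧
      Tendsto (fun N : ℕ => ((E N).card : ℝ) / (N : ℝ) ^ n) atTop (nhds 0) ∧
      ∀ N : ℕ, ∀ f ∈ P0 n N \ E N,
        (((fieldDisc n f).natAbs.primeFactors.card : ℝ)) ≤ C * Real.log (Real.log (N : ℝ)) := by
  obtain ⟨A, hA, hsum⟩ := sum_inv_primesLE_le
  have hn1 : 1 ≤ n := by omega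
  have hn0 : (0 : ℝ) < n := by exact_mod_cast hn1
  refine ⟨8 * n * A, by positivity, fun N => (P0 n N).filter fun f =>
    ¬ ((fieldDisc n f).natAbs.primeFactors.card : ℝ) ≤ 8 * n * A * Real.log (Real.log N),
    fun N => Finset.filter_subset _ _, ?_, ?_⟩
  · rw [Metric.tendsto_nhds]
    intro ε hε
    obtain ⟨k, hk⟩ := exists_pow_lt_of_lt_one (show 0 < ε / 4 ^ n by positivity)
      (show (1 / 2 : ℝ) < 1 by norm_num)
    have hk' : (4 : ℝ) ^ n * (1 / 2) ^ (k + 1) < ε := by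
      rw [lt_div_iff₀' (by positivity)] at hk
      refine lt_of_le_of_lt ?_ hk
      gcongr ?_ * ?_
      exact pow_le_pow_of_le_one (by norm_num) (by norm_num) (Nat.le_succ k)
    filter_upwards [eventually_card_many_ramified_le hn1 hA hsum (Nat.le_add_left 1 k), eventually_ge_atTop 1]
      with N hN hN1
    have hNpos : (0 : ℝ) < (N : ℝ) ^ n := by
      have : (0 : ℝ) < N := by exact_mod_cast hN1
      positivity
    rw [Real.dist_eq, sub_zero, abs_of_nonneg (by positivity)]
    exact lt_of_le_of_lt ((div_le_iff₀ hNpos).2 hN) hk'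
  · intro N f hf
    rw [Finset.mem_sdiff, Finset.mem_filter, not_and, not_not] at hf
    exact hf.2 hf.1

end
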